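/- Let G be a finite group in which every maximal subgroup is supersolvable. Then G is solvable. -/

import Mathlib

/-- A group is supersolvable if it has a chain of subgroups from `⊥` to `⊤`,
each normal in the whole group, with each successive factor cyclic
(i.e. each term is generated by the previous term together with one element). -/
def IsSupersolvable (G : Type*) [Group G] : Prop :=
  ∃ (n : ℕ) (s : Fin (n + 1) → Subgroup G),
    s 0 = ⊥ ∧ s (Fin.last n) = ⊤ ∧ (∀ i, (s i).Normal) ∧
    ∀ i : Fin n, ∃ x : G, s i.succ = s i.castSucc ⊔ Subgroup.closure {x}

open Subgroup
open scoped Pointwise commutatorElement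

/-- Supersolvability passes to homomorphic images. -/
theorem IsSupersolvable.of_surjective {G H : Type*} [Group G] [Group H] (f : G →* H)
    (hf : Function.Surjective f) (hG : IsSupersolvable G) : IsSupersolvable H := by
  obtain ⟨n, s, h0, h1, hn, hs⟩ := hG
  refine ⟨n, fun i ↦ (s i).map f, by simp [h0], by simp [h1, map_top_of_surjective f hf],
    fun i ↦ (hn i).map f hf, fun i ↦ ?_⟩
  obtain ⟨x, hx⟩ := hs i
  exact ⟨f x, by simp [hx, Subgroup.map_sup, MonoidHom.map_closure]⟩

/-- A subgroup of `A ⊔ ⟨y⟩` has cyclic image modulo the normal subgroup `A`. -/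
theorem Subgroup.isCyclic_map_mk'_of_le_sup_closure_singleton {G : Type*} [Group G]
    {A B : Subgroup G} [A.Normal] {y : G} (hB : B ≤ A ⊔ closure {y}) :
    IsCyclic (B.map (QuotientGroup.mk' A)) := by
  refine isCyclic_of_le (H' := zpowers (y : G ⧸ A)) ((map_mono hB).trans ?_)
  rw [Subgroup.map_sup, MonoidHom.map_closure]
  simp [zpowers_eq_closure]

/-- Supersolvable groups are solvable. -/
theorem IsSupersolvable.isSolvable {G : Type*} [Group G] (hG : IsSupersolvable G) :
    Group.IsSolvable G := by
  obtain ⟨n, s, h0, h1, hn, hs⟩ := hG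
  suffices ∀ i, Group.IsSolvable (s i) by
    have := this (Fin.last n)
    rw [h1] at this
    exact Group.isSolvable_of_surjective (f := (⊤ : Subgroup G).subtype) (fun x ↦ ⟨⟨x, mem_top x⟩, rfl⟩)
  intro i
  induction i using Fin.induction with
  | zero => rw [h0]; infer_instance
  | succ i ih =>
    obtain ⟨y, hy⟩ := hs i
    have := hn i.castSucc
    have hle : s i.castSucc ≤ s i.succ := hy ▸ le_sup_left
    have := isCyclic_map_mk'_of_le_sup_closure_singleton hy.le
    have : Group.IsSolvable ((s i.succ).map (QuotientGroup.mk' (s i.castSucc))) :=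
      Group.isSolvable_of_comm IsCyclic.isMulCommutative.is_comm.comm
    refine Group.isSolvable_of_ker_le_range (inclusion hle)
      ((QuotientGroup.mk' (s i.castSucc)).subgroupMap (s i.succ)) fun x hx ↦ ?_
    have hx' : (x : G) ∈ s i.castSucc := by
      simpa [Subtype.ext_iff] using hx
    exact ⟨⟨x, hx'⟩, rfl⟩

/-- A `p`-subgroup contains elements outside any proper subgroup `D` that normalize `D`. -/
theorem IsPGroup.lt_inf_normalizer {G : Type*} [Group G] [Finite G] {p : ℕ} [Fact p.Prime]
    {D H : Subgroup G} (hH : IsPGroup p H) (hD : D < H) : D < H ⊓ normalizer (D : Set G) := by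
  have := hH.isNilpotent
  have h1 : D.subgroupOf H < ⊤ := by
    rw [lt_top_iff_ne_top, Ne, subgroupOf_eq_top]
    exact hD.not_ge
  have h2 := Group.normalizerCondition_of_isNilpotent (G := H) _ h1
  rw [← subgroupOf_normalizer_eq hD.le] at h2
  refine lt_of_le_of_ne (le_inf hD.le le_normalizer) fun h ↦ h2.ne ?_
  conv_lhs => rw [h]
  simp

/-- A quotient by a normal subgroup containing all elements of order prime to `p` is a
`p`-group. -/
theorem IsPGroup.quotient_of_coprime_mem {G : Type*} [Group G] [Finite G] {p : ℕ} [Fact p.Prime]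
    {C : Subgroup G} [C.Normal] (hC : ∀ x : G, (orderOf x).Coprime p → x ∈ C) :
    IsPGroup p (G ⧸ C) := by
  intro q
  induction q using QuotientGroup.induction_on with
  | H x =>
    refine ⟨(orderOf x).factorization p, ?_⟩
    rw [← QuotientGroup.mk_pow, QuotientGroup.eq_one_iff]
    apply hC
    rw [orderOf_pow_of_dvd (pow_ne_zero _ (Fact.out : p.Prime).ne_zero) (Nat.ordProj_dvd _ _)]
    exact (Nat.coprime_ordCompl Fact.out (orderOf_pos x).ne').symm

/-- If `G ⧸ C` is a `p`-group, then `C` and any Sylow `p`-subgroup generate `G`. -/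
theorem Sylow.sup_eq_top_of_quotient {G : Type*} [Group G] [Finite G] {p : ℕ} [Fact p.Prime]
    {C : Subgroup G} [C.Normal] (hC : IsPGroup p (G ⧸ C)) (S : Sylow p G) :
    (S : Subgroup G) ⊔ C = ⊤ := by
  rw [← index_eq_one]
  obtain ⟨n, hn⟩ := IsPGroup.iff_card.mp hC
  rw [← index_eq_card] at hn
  refine Nat.eq_one_of_dvd_coprimes (a := p ^ n) (b := S.index) ?_
    (hn ▸ index_dvd_of_le le_sup_right) (index_dvd_of_le le_sup_left)
  exact Nat.Coprime.pow_left _ (((Fact.out : p.Prime).coprime_iff_not_dvd).mpr S.not_dvd_index)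

/-- In a finite group with a normal subgroup `C` of `p`-power index, any two `p`-subgroups have
`C`-conjugates in a common Sylow subgroup. -/
theorem IsPGroup.exists_conj_le_sylow_of_quotient {G : Type*} [Group G] [Finite G] {p : ℕ}
    [Fact p.Prime] {C A B : Subgroup G} [C.Normal] (hC : IsPGroup p (G ⧸ C)) (hA : IsPGroup p A)
    (hB : IsPGroup p B) :
    ∃ c ∈ C, ∃ R : Sylow p G, A ≤ R ∧ ∀ b ∈ B, c * b * c⁻¹ ∈ R := by
  obtain ⟨S, hS⟩ := hA.exists_le_sylow
  obtain ⟨T, hT⟩ := hB.exists_le_sylow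
  obtain ⟨g, hg⟩ := MulAction.exists_smul_eq G T S
  have htop := S.sup_eq_top_of_quotient hC
  obtain ⟨s, hs, c, hc, rfl⟩ := mem_sup_of_normal_right.mp (htop ▸ mem_top g)
  refine ⟨c, hc, S, hS, fun b hb ↦ ?_⟩
  rw [mul_smul] at hg
  have hcT : c • T = S := by
    rw [← inv_smul_eq_iff.mpr hg.symm, Sylow.smul_eq_iff_mem_normalizer]
    exact inv_mem (le_normalizer hs)
  rw [← hcT]
  exact smul_mem_pointwise_smul b (MulAut.conj c) (T : Subgroup G) (hT hb)

instance Subgroup.normal_centralizer_subgroupOf_normalizer {G : Type*} [Group G]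
    (D : Subgroup G) :
    ((centralizer (D : Set G)).subgroupOf (normalizer (D : Set G))).Normal := by
  rw [← normalizerMonoidHom_ker]
  infer_instance

theorem IsPGroup.normalizer_quotient_centralizer {G : Type*} [Group G] [Finite G] {p : ℕ}
    [Fact p.Prime] {D : Subgroup G}
    (hD : ∀ x ∈ normalizer (D : Set G), (orderOf x).Coprime p → x ∈ centralizer (D : Set G)) :
    IsPGroup p
      (normalizer (D : Set G) ⧸ (centralizer (D : Set G)).subgroupOf (normalizer (D : Set G))) :=
  IsPGroup.quotient_of_coprime_mem fun x hx ↦ hD x x.2 (by rwa [orderOf_coe])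

/-- If the `p'`-elements of `N(D)` centralize `D`, then any two `p`-subgroups of `N(D)` have
`C(D)`-conjugates in a common Sylow subgroup of `G`. -/
theorem IsPGroup.exists_centralizer_conj_le_sylow {G : Type*} [Group G] [Finite G] {p : ℕ}
    [Fact p.Prime] {D A B : Subgroup G}
    (hD : ∀ x ∈ normalizer (D : Set G), (orderOf x).Coprime p → x ∈ centralizer (D : Set G))
    (hA : IsPGroup p A) (hB : IsPGroup p B) (hAN : A ≤ normalizer (D : Set G))
    (hBN : B ≤ normalizer (D : Set G)) :
    ∃ c ∈ centralizer (D : Set G), ∃ R : Sylow p G, A ≤ R ∧ ∀ b ∈ B, c * b * c⁻¹ ∈ R := by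
  have hq := IsPGroup.normalizer_quotient_centralizer hD
  obtain ⟨c, hc, R, hAR, hBR⟩ := hq.exists_conj_le_sylow_of_quotient
    (hA.comap_subtype (K := normalizer (D : Set G)))
    (hB.comap_subtype (K := normalizer (D : Set G)))
  obtain ⟨R', hR'⟩ := (R.2.map (normalizer (D : Set G)).subtype).exists_le_sylow
  exact ⟨c, hc, R', fun a ha ↦ hR' ⟨⟨a, hAN ha⟩, hAR ha, rfl⟩,
    fun b hb ↦ hR' ⟨_, hBR ⟨b, hBN hb⟩ hb, rfl⟩⟩

/-- If `N(D) / C(D)` is a `p`-group for every `p`-subgroup `D`, then two Sylow subgroups are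
conjugate by an element centralizing their intersection. -/
theorem Sylow.exists_mem_centralizer_inf_smul_eq {G : Type*} [Group G] [Finite G] {p : ℕ}
    [Fact p.Prime]
    (h : ∀ D : Subgroup G, IsPGroup p D → ∀ x ∈ normalizer (D : Set G), (orderOf x).Coprime p →
      x ∈ centralizer (D : Set G)) (P Q : Sylow p G) :
    ∃ c ∈ centralizer (((P : Subgroup G) ⊓ Q : Subgroup G) : Set G), c • Q = P := by
  obtain ⟨D, hPQ⟩ : ∃ D : Subgroup G, D = (P : Subgroup G) ⊓ Q := ⟨_, rfl⟩
  induction D using WellFoundedGT.induction generalizing P Q with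
  | ind D ih =>
  rw [← hPQ]
  by_cases hP : (P : Subgroup G) ≤ Q
  · exact ⟨1, one_mem _, by simpa using Sylow.ext (P.3 Q.2 hP)⟩
  have hQ : ¬ (Q : Subgroup G) ≤ P := fun hQ ↦ hP (Q.3 P.2 hQ).le
  have hDP : D < P := hPQ ▸ inf_lt_left.mpr hP
  have hDQ : D < Q := hPQ ▸ inf_lt_right.mpr hQ
  obtain ⟨c, hc, R, hPR, hQR⟩ := IsPGroup.exists_centralizer_conj_le_sylow
    (h D (P.2.to_le hDP.le)) P.2.to_inf_left Q.2.to_inf_left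
    (inf_le_right (b := normalizer (D : Set G))) (inf_le_right (b := normalizer (D : Set G)))
  have hDPR : D < (P : Subgroup G) ⊓ R :=
    (P.2.lt_inf_normalizer hDP).trans_le (le_inf inf_le_left hPR)
  have hDRQ : D < (R : Subgroup G) ⊓ (c • Q : Sylow p G) := by
    obtain ⟨y, ⟨hyQ, hyN⟩, hyD⟩ := SetLike.exists_of_lt (Q.2.lt_inf_normalizer hDQ)
    have hcD : ∀ d ∈ D, c * d * c⁻¹ = d := fun d hd ↦ by
      rw [← hc d hd, mul_inv_cancel_right]
    have hQ' : ∀ q ∈ Q, c * q * c⁻¹ ∈ (c • Q : Sylow p G) := fun q hq ↦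
      smul_mem_pointwise_smul q (MulAut.conj c) (Q : Subgroup G) hq
    refine lt_of_le_not_ge (fun d hd ↦ ?_) fun hle ↦ hyD ?_
    · refine ⟨(hDPR.le hd).2, ?_⟩
      have := hQ' d (hDQ.le hd)
      rwa [hcD d hd] at this
    · have hmem : c * y * c⁻¹ ∈ D := hle ⟨hQR y ⟨hyQ, hyN⟩, hQ' y hyQ⟩
      have hy : c * y * c⁻¹ = y := by
        simpa [mul_assoc] using (show c * y * c⁻¹ * c = c * (c * y * c⁻¹) from hc _ hmem).symm
      rwa [hy] at hmem
  obtain ⟨c₁, hc₁, h₁⟩ := ih _ hDPR P R rfl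
  obtain ⟨c₂, hc₂, h₂⟩ := ih _ hDRQ R (c • Q) rfl
  refine ⟨c₁ * (c₂ * c), mul_mem (centralizer_le hDPR.le hc₁)
    (mul_mem (centralizer_le hDRQ.le hc₂) hc), ?_⟩
  rw [mul_smul, mul_smul, h₂, h₁]

/-- If `N(D) / C(D)` is a `p`-group for every `p`-subgroup `D`, then a Sylow subgroup controls
its own fusion. -/
theorem Sylow.exists_mem_conj_eq {G : Type*} [Group G] [Finite G] {p : ℕ}
    [Fact p.Prime]
    (h : ∀ D : Subgroup G, IsPGroup p D → ∀ x ∈ normalizer (D : Set G), (orderOf x).Coprime p →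
      x ∈ centralizer (D : Set G)) (P : Sylow p G) {x u : G} (hx : x ∈ P)
    (hxu : u * x * u⁻¹ ∈ P) : ∃ v ∈ P, v * x * v⁻¹ = u * x * u⁻¹ := by
  obtain ⟨c, hc, hcP⟩ := Sylow.exists_mem_centralizer_inf_smul_eq h P (u • P)
  have hux : u * x * u⁻¹ ∈ (u • P : Sylow p G) :=
    smul_mem_pointwise_smul x (MulAut.conj u) (P : Subgroup G) hx
  have hcu := hc _ ⟨hxu, hux⟩
  rw [← mul_smul, Sylow.smul_eq_iff_mem_normalizer] at hcP
  obtain ⟨s, hs, k, hk, hsk⟩ := mem_sup_of_normal_right.mp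
    ((P.subtype le_normalizer).sup_eq_top_of_quotient
      (IsPGroup.normalizer_quotient_centralizer (h P P.2)) ▸
        mem_top (⟨c * u, hcP⟩ : normalizer (P : Set G)))
  refine ⟨s, hs, ?_⟩
  have hkx : k * x * (k : G)⁻¹ = x := by
    rw [← show x * (k : G) = k * x from hk x hx, mul_inv_cancel_right]
  have hsk' : (s : G) * k = c * u := congrArg Subtype.val hsk
  calc (s : G) * x * (s : G)⁻¹ = (s * k) * x * (s * k : G)⁻¹ := by
        conv_lhs => rw [← hkx]
        group
    _ = c * (u * x * u⁻¹) * c⁻¹ := by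
        rw [hsk']
        group
    _ = u * x * u⁻¹ := by rw [← hcu, mul_inv_cancel_right]

/-- If `N(D) / C(D)` is a `p`-group for every `p`-subgroup `D`, then the commutator subgroup of
`G` meets a Sylow subgroup `P` in the commutator subgroup of `P`. -/
theorem Sylow.commutator_inf_eq {G : Type*} [Group G] [Finite G] {p : ℕ}
    [Fact p.Prime]
    (h : ∀ D : Subgroup G, IsPGroup p D → ∀ x ∈ normalizer (D : Set G), (orderOf x).Coprime p →
      x ∈ centralizer (D : Set G)) (P : Sylow p G) :
    commutator G ⊓ P = ⁅(P : Subgroup G), (P : Subgroup G)⁆ := by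
  refine le_antisymm ?_ (le_inf (commutator_mono le_top le_top) P.commutator_le_self)
  rw [commutator_inf_eq_focalSubgroup, focalSubgroup_def, closure_le]
  rintro _ ⟨hP, x, hx, u, rfl⟩
  have hxu : u * x * u⁻¹ ∈ P := by
    have := mul_mem (inv_mem hP) hx
    exact (show _ ∈ (P : Subgroup G) by simpa [commutatorElement_def, mul_assoc] using this)
  obtain ⟨v, hv, hvu⟩ := P.exists_mem_conj_eq h hx hxu
  have : ⁅x, u⁆ = ⁅x, v⁆ := by
    have e : ∀ w : G, ⁅x, w⁆ = x * (w * x * w⁻¹)⁻¹ := fun w ↦ by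
      simp [commutatorElement_def, mul_assoc]
    rw [e, e, hvu]
  rw [this]
  exact commutator_mem_commutator hx hv

/-- An element normalizing a cyclic `p`-subgroup and of order prime to `p (p - 1)` centralizes
it. -/
theorem IsPGroup.mem_centralizer_of_isCyclic {G : Type*} [Group G] [Finite G] {p : ℕ}
    [Fact p.Prime] {C : Subgroup G} [IsCyclic C] (hC : IsPGroup p C) {x : G}
    (hx : x ∈ normalizer (C : Set G)) (hp : (orderOf x).Coprime p)
    (hp1 : (orderOf x).Coprime (p - 1)) : x ∈ centralizer (C : Set G) := by
  have hcop : (orderOf x).Coprime (Nat.card (MulAut C)) := by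
    obtain ⟨n, hn⟩ := IsPGroup.iff_card.mp hC
    rw [IsCyclic.card_mulAut, hn]
    rcases n.eq_zero_or_pos with rfl | hpos
    · simp
    · rw [Nat.totient_prime_pow Fact.out hpos]
      exact (hp.pow_right _).mul_right hp1
  suffices (⟨x, hx⟩ : normalizer (C : Set G)) ∈ C.normalizerMonoidHom.ker by
    rwa [normalizerMonoidHom_ker] at this
  rw [MonoidHom.mem_ker, ← orderOf_eq_one_iff]
  refine Nat.eq_one_of_dvd_coprimes hcop ?_ (orderOf_dvd_natCard _)
  simpa using orderOf_map_dvd C.normalizerMonoidHom ⟨x, hx⟩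

/-- In a supersolvable group, an element normalizing a `p`-subgroup and of order prime to
`p (p - 1)` centralizes it. -/
theorem IsSupersolvable.mem_centralizer {G : Type*} [Group G] [Finite G] {p : ℕ}
    [Fact p.Prime] (hG : IsSupersolvable G) {D : Subgroup G} (hD : IsPGroup p D) {x : G}
    (hx : x ∈ normalizer (D : Set G)) (hp : (orderOf x).Coprime p)
    (hp1 : (orderOf x).Coprime (p - 1)) : x ∈ centralizer (D : Set G) := by
  obtain ⟨n, s, h0, h1, hn, hs⟩ := hG
  suffices ∀ i, ∀ d ∈ D ⊓ s i, d * x = x * d from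
    fun d hd ↦ this (Fin.last n) d ⟨hd, h1 ▸ mem_top d⟩
  intro i
  induction i using Fin.induction with
  | zero => simp [h0]
  | succ i ih =>
    intro d hd
    obtain ⟨y, hy⟩ := hs i
    have hA := hn i.castSucc
    have hB := hn i.succ
    have hcyc :=
      isCyclic_map_mk'_of_le_sup_closure_singleton (inf_le_right.trans hy.le : D ⊓ _ ≤ _)
    have hxB : x ∈ normalizer ((D ⊓ s i.succ : Subgroup G) : Set G) := by
      rw [mem_normalizer_iff] at hx ⊢
      intro h
      rw [mem_inf, mem_inf, ← hx h, ← hB.mem_comm_iff, inv_mul_cancel_left]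
    have hxC := le_normalizer_map (QuotientGroup.mk' (s i.castSucc)) (mem_map_of_mem _ hxB)
    have hdvd := orderOf_map_dvd (QuotientGroup.mk' (s i.castSucc)) x
    have hpB := (hD.to_inf_left (K := s i.succ)).map (QuotientGroup.mk' (s i.castSucc))
    have hcen := hpB.mem_centralizer_of_isCyclic hxC
      (hp.coprime_dvd_left hdvd) (hp1.coprime_dvd_left hdvd)
    have hdx := hcen _ (mem_map_of_mem _ hd)
    obtain ⟨a, ha⟩ : ∃ a, a = x * d * x⁻¹ * d⁻¹ := ⟨_, rfl⟩
    have haA : a ∈ s i.castSucc := by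
      rw [← QuotientGroup.ker_mk' (s i.castSucc), MonoidHom.mem_ker, ha, map_mul, map_mul,
        map_mul, ← hdx]
      simp
    have haD : a ∈ D := ha ▸ mul_mem ((mem_normalizer_iff.mp hx d).mp hd.1) (inv_mem hd.1)
    have hax : a * x = x * a := ih a ⟨haD, haA⟩
    have hconj : d * x⁻¹ * d⁻¹ = x⁻¹ * a := by rw [ha]; group
    have hpow : a ^ orderOf x = 1 := by
      have h2 : (x⁻¹ * a) ^ orderOf x = 1 := by
        rw [← hconj, conj_pow, inv_pow, pow_orderOf_eq_one]
        simp
      rw [((show Commute x a from hax.symm).inv_left).mul_pow, inv_pow, pow_orderOf_eq_one] at h2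
      simpa using h2
    have ha1 : a = 1 := by
      rw [← orderOf_eq_one_iff]
      refine Nat.eq_one_of_dvd_coprimes (hD.orderOf_coprime hp.symm ⟨a, haD⟩) ?_
        (orderOf_dvd_of_pow_eq_one hpow)
      simp
    have := ha1 ▸ ha
    rw [eq_comm, mul_inv_eq_one, mul_inv_eq_iff_eq_mul] at this
    exact this.symm

/-- A weak form of **Frobenius' normal `p`-complement theorem**. -/
theorem Sylow.commutator_ne_top {G : Type*} [Group G] [Finite G] {p : ℕ} [Fact p.Prime]
    (h : ∀ D : Subgroup G, IsPGroup p D → ∀ x ∈ normalizer (D : Set G), (orderOf x).Coprime p →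
      x ∈ centralizer (D : Set G)) (hp : p ∣ Nat.card G) : commutator G ≠ ⊤ := by
  intro htop
  obtain ⟨P⟩ : Nonempty (Sylow p G) := inferInstance
  have hP := P.commutator_inf_eq h
  have := P.2.isNilpotent
  have : Nontrivial P :=
    (P : Subgroup G).nontrivial_iff_ne_bot.mpr (P.ne_bot_of_dvd_card hp)
  refine (Group.IsSolvable.commutator_lt_top_of_nontrivial (G := P)).ne
    (map_injective (P : Subgroup G).subtype_injective ?_)
  rw [map_subtype_commutator, ← hP, htop, top_inf_eq, ← MonoidHom.range_eq_map, range_subtype]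

theorem mem_centralizer_of_isSupersolvable_isCoatom {G : Type*} [Group G] [Finite G]
    [IsSimpleGroup G] (h : ∀ M : Subgroup G, IsCoatom M → IsSupersolvable M)
    [Fact (Nat.card G).minFac.Prime] (hG : ¬ IsPGroup (Nat.card G).minFac G)
    {D : Subgroup G} (hD : IsPGroup (Nat.card G).minFac D) {x : G}
    (hx : x ∈ normalizer (D : Set G)) (hp : (orderOf x).Coprime (Nat.card G).minFac) :
    x ∈ centralizer (D : Set G) := by
  rcases eq_top_or_exists_le_coatom (normalizer (D : Set G)) with htop | ⟨M, hM, hle⟩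
  · rcases (normalizer_eq_top_iff.mp htop).eq_bot_or_eq_top with rfl | rfl
    · simp [mem_centralizer_iff]
    · exact absurd (hD.of_equiv topEquiv) hG
  · have hDM : D ≤ M := le_normalizer.trans hle
    have hp1 : (orderOf x).Coprime ((Nat.card G).minFac - 1) := by
      refine Nat.coprime_of_dvd fun q hq hqx hqp ↦ ?_
      have h2 := (Fact.out : (Nat.card G).minFac.Prime).two_le
      have h3 := Nat.le_of_dvd (by omega) hqp
      have h4 := Nat.minFac_le_of_dvd hq.two_le (hqx.trans (orderOf_dvd_natCard x))
      omega
    have hxM : (⟨x, hle hx⟩ : M) ∈ normalizer ((D.subgroupOf M : Subgroup M) : Set M) := by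
      rwa [← subgroupOf_normalizer_eq hDM]
    have := (h M hM).mem_centralizer hD.comap_subtype hxM (by rwa [orderOf_mk])
      (by rwa [orderOf_mk])
    exact fun d hd ↦ congrArg Subtype.val (this ⟨d, hDM hd⟩ hd)

theorem isSolvable_of_isSimpleGroup_of_isSupersolvable_isCoatom {G : Type*} [Group G] [Finite G]
    [IsSimpleGroup G] (h : ∀ M : Subgroup G, IsCoatom M → IsSupersolvable M) :
    Group.IsSolvable G := by
  have hp : Fact (Nat.card G).minFac.Prime := ⟨Nat.minFac_prime Finite.one_lt_card.ne'⟩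
  by_cases hG : IsPGroup (Nat.card G).minFac G
  · have := hG.isNilpotent
    infer_instance
  · have htop := Sylow.commutator_ne_top
      (fun D hD x hx ↦ mem_centralizer_of_isSupersolvable_isCoatom h hG hD hx)
      (Nat.minFac_dvd _)
    have hbot := (inferInstance : (commutator G).Normal).eq_bot_or_eq_top.resolve_right htop
    exact ⟨1, by rwa [derivedSeries_one]⟩

theorem isSupersolvable_isCoatom_quotient {G : Type*} [Group G] (N : Subgroup G) [N.Normal]
    (h : ∀ M : Subgroup G, IsCoatom M → IsSupersolvable M) (M : Subgroup (G ⧸ N))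
    (hM : IsCoatom M) : IsSupersolvable M :=
  (h _ (isCoatom_comap_of_surjective (QuotientGroup.mk'_surjective N) hM)).of_surjective
    ((QuotientGroup.mk' N).subgroupComap M)
    ((QuotientGroup.mk' N).subgroupComap_surjective_of_surjective M
      (QuotientGroup.mk'_surjective N))

theorem doerk_solvable_of_maximal_supersolvable (G : Type*) [Group G] [Finite G]
    (h : ∀ M : Subgroup G, IsCoatom M → IsSupersolvable M) :
    IsSolvable G := by
  change Group.IsSolvable G
  induction hn : Nat.card G using Nat.strong_induction_on generalizing G with
  | h n ih =>
  rcases subsingleton_or_nontrivial G with _ | _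
  · infer_instance
  by_cases hG : IsSimpleGroup G
  · exact isSolvable_of_isSimpleGroup_of_isSupersolvable_isCoatom h
  obtain ⟨N, hN, hbot, htop⟩ : ∃ N : Subgroup G, N.Normal ∧ N ≠ ⊥ ∧ N ≠ ⊤ := by
    by_contra! hcon
    exact hG ⟨fun N hN ↦ or_iff_not_imp_left.mpr (hcon N hN)⟩
  obtain ⟨M, hM, hNM⟩ := (eq_top_or_exists_le_coatom N).resolve_left htop
  have := (h M hM).isSolvable
  rw [Group.isSolvable_iff_subgroup_quotient N]
  refine ⟨Group.isSolvable_of_isSolvable_injective (inclusion_injective hNM),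
    ih _ ?_ (G ⧸ N) (isSupersolvable_isCoatom_quotient N h) rfl⟩
  rw [← hn, N.card_eq_card_quotient_mul_card_subgroup]
  exact lt_mul_of_one_lt_right Nat.card_pos (N.one_lt_card_iff_ne_bot.mpr hbot)
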